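/- arXiv:2604.04975 — 2 statements merged into one kernel-verified Lean document; each statement's English description precedes it below -/
import Mathlib

section
/- There exists a Steiner system S(2,7,589): a set V with 589 elements together with a family 𝓑 of 7-element subsets of V (blocks) such that every 2-element subset of V is contained in exactly one block of 𝓑. -/
/-- The translates of the base blocks `F i` by the elements of `G`. -/
def translateBlocks {G ι κ : Type*} [AddCommGroup G] [Fintype G] [DecidableEq G] [Fintype ι]
    [Fintype κ] (F : ι → κ → G) : Finset (Finset G) :=
  Finset.univ.image fun x : G × ι => Finset.univ.image fun j => F x.2 j + x.1

/-- If every nonzero element of `G` is a difference of two entries of a base block in exactly one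
way, then every pair of points lies in exactly one translate of a base block. -/
theorem existsUnique_translateBlocks {G ι κ : Type*} [AddCommGroup G] [Fintype G] [DecidableEq G]
    [Fintype ι] [Fintype κ] (F : ι → κ → G)
    (hF : ∀ d : G, d ≠ 0 → ∃! t : ι × κ × κ, F t.1 t.2.1 - F t.1 t.2.2 = d)
    (p : Finset G) (hp : p.card = 2) : ∃! b, b ∈ translateBlocks F ∧ p ⊆ b := by
  obtain ⟨a, b, hab, rfl⟩ := Finset.card_eq_two.mp hp
  obtain ⟨⟨i, j, k⟩, ht, huniq⟩ := hF (a - b) (sub_ne_zero.mpr hab)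
  dsimp only at ht
  refine ⟨Finset.univ.image fun l => F i l + (a - F i j), ⟨?_, ?_⟩, ?_⟩
  · exact Finset.mem_image.mpr ⟨(a - F i j, i), Finset.mem_univ _, rfl⟩
  · simp only [Finset.insert_subset_iff, Finset.singleton_subset_iff, Finset.mem_image,
      Finset.mem_univ, true_and]
    refine ⟨⟨j, by abel⟩, ⟨k, ?_⟩⟩
    rw [sub_eq_iff_eq_add.mp ht]
    abel
  · rintro c ⟨hc, hsub⟩
    obtain ⟨⟨g, i'⟩, -, rfl⟩ := Finset.mem_image.mp hc
    simp only [Finset.insert_subset_iff, Finset.singleton_subset_iff, Finset.mem_image,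
      Finset.mem_univ, true_and] at hsub
    obtain ⟨⟨j', hj'⟩, ⟨k', hk'⟩⟩ := hsub
    have h := huniq (i', j', k') (by simp [← hj', ← hk'])
    simp only [Prod.mk.injEq] at h
    obtain ⟨rfl, rfl, rfl⟩ := h
    simp [← hj']

theorem card_of_mem_translateBlocks {G ι κ : Type*} [AddCommGroup G] [Fintype G] [DecidableEq G]
    [Fintype ι] [Fintype κ] {F : ι → κ → G} (hF : ∀ i, Function.Injective (F i))
    {b : Finset G} (hb : b ∈ translateBlocks F) : b.card = Fintype.card κ := by
  obtain ⟨⟨g, i⟩, -, rfl⟩ := Finset.mem_image.mp hb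
  exact Finset.card_image_of_injective _ ((add_left_injective g).comp (hF i))

/-- The translates of a difference family form a Steiner system `S(2, k, v)`. -/
theorem exists_steiner_system_of_differences {G ι κ : Type} [AddCommGroup G] [Fintype G]
    [DecidableEq G] [Fintype ι] [Fintype κ] {v k : ℕ} (hv : Fintype.card G = v)
    (hk : Fintype.card κ = k) (F : ι → κ → G) (hinj : ∀ i, Function.Injective (F i))
    (hF : ∀ d : G, d ≠ 0 → ∃! t : ι × κ × κ, F t.1 t.2.1 - F t.1 t.2.2 = d) :
    ∃ (V : Type) (_ : Fintype V), Fintype.card V = v ∧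
      ∃ 𝓑 : Finset (Finset V),
        (∀ b ∈ 𝓑, b.card = k) ∧
        ∀ p : Finset V, p.card = 2 → ∃! b, b ∈ 𝓑 ∧ p ⊆ b :=
  ⟨G, inferInstance, hv, translateBlocks F,
    fun _ hb => (card_of_mem_translateBlocks hinj hb).trans hk, existsUnique_translateBlocks F hF⟩

/-- If the differences of distinct positions in the base blocks cover the nonzero elements of `G`
and there are no more of them than nonzero elements, then `F` is a difference family. -/
theorem injective_and_existsUnique_of_surjective {G ι κ : Type*} [AddCommGroup G] [Fintype G]
    [DecidableEq G] [Fintype ι] [Fintype κ] [DecidableEq κ] (F : ι → κ → G)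
    (hcard : Fintype.card {t : ι × κ × κ // t.2.1 ≠ t.2.2} + 1 = Fintype.card G)
    (hsurj : ∀ d : G, d ≠ 0 → ∃ t : ι × κ × κ, F t.1 t.2.1 - F t.1 t.2.2 = d) :
    (∀ i, Function.Injective (F i)) ∧
      ∀ d : G, d ≠ 0 → ∃! t : ι × κ × κ, F t.1 t.2.1 - F t.1 t.2.2 = d := by
  let δ : Option {t : ι × κ × κ // t.2.1 ≠ t.2.2} → G :=
    fun o => o.elim 0 fun t => F t.1.1 t.1.2.1 - F t.1.1 t.1.2.2
  have hne : ∀ {d : G} {t : ι × κ × κ}, d ≠ 0 → F t.1 t.2.1 - F t.1 t.2.2 = d →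
      t.2.1 ≠ t.2.2 := by
    rintro d t hd ht h
    exact hd (by rw [← ht, h, sub_self])
  have hδ : Function.Surjective δ := by
    intro d
    by_cases hd : d = 0
    · exact ⟨none, hd.symm⟩
    · obtain ⟨t, ht⟩ := hsurj d hd
      exact ⟨some ⟨t, hne hd ht⟩, ht⟩
  have hinj : Function.Injective δ :=
    ((Fintype.bijective_iff_surjective_and_card δ).mpr ⟨hδ, by simpa using hcard⟩).1
  refine ⟨fun i j k hjk => ?_, fun d hd => ?_⟩
  · by_contra h
    have : δ (some ⟨(i, j, k), h⟩) = δ none := sub_eq_zero.mpr hjk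
    simpa using hinj this
  · obtain ⟨t, ht⟩ := hsurj d hd
    refine ⟨t, ht, fun s hs => ?_⟩
    have : δ (some ⟨s, hne hd hs⟩) = δ (some ⟨t, hne hd ht⟩) := hs.trans ht.symm
    simpa using hinj this

/-- The number whose binary digits mark the elements of `l`. -/
def bitMask (l : List ℕ) : ℕ := l.foldr (fun d m => m ||| 2 ^ d) 0

theorem testBit_bitMask (l : List ℕ) (d : ℕ) : (bitMask l).testBit d = true ↔ d ∈ l := by
  induction l with
  | nil => simp [bitMask]
  | cons a l ih =>
    have : bitMask (a :: l) = bitMask l ||| 2 ^ a := rfl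
    rw [this, Nat.testBit_or, Nat.testBit_two_pow, Bool.or_eq_true, ih, decide_eq_true_iff,
      List.mem_cons, or_comm, eq_comm (a := a)]

/-- Representatives of the base blocks of a cyclic `(589, 7, 1)` difference family. -/
def baseBlocks589 : Fin 14 → Fin 7 → ℕ :=
  ![![0, 126, 245, 367, 390, 453, 550],
    ![0, 99, 103, 188, 233, 431, 487],
    ![0, 111, 123, 141, 357, 360, 537],
    ![0, 132, 253, 415, 447, 525, 530],
    ![0, 118, 127, 164, 331, 480, 587],
    ![0, 15, 168, 176, 218, 293, 322],
    ![0, 178, 214, 248, 349, 403, 499],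
    ![0, 16, 239, 263, 465, 505, 558],
    ![0, 172, 310, 324, 359, 372, 416],
    ![0, 182, 351, 502, 521, 562, 579],
    ![0, 20, 94, 291, 329, 476, 588],
    ![0, 7, 88, 308, 498, 520, 563],
    ![0, 67, 215, 446, 517, 528, 583],
    ![0, 181, 289, 405, 433, 484, 564]]

/-- All differences modulo `589` of two entries of a base block. -/
def differences589 : List ℕ :=
  (List.finRange 14).flatMap fun i => (List.finRange 7).flatMap fun j =>
    (List.finRange 7).map fun k => (baseBlocks589 i j + (589 - baseBlocks589 i k)) % 589

theorem bitMask_differences589 : bitMask differences589 = 2 ^ 589 - 1 := by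
  decide +kernel

theorem baseBlocks589_lt (i : Fin 14) (j : Fin 7) : baseBlocks589 i j < 589 := by
  revert i j
  decide +kernel

theorem exists_baseBlocks589_sub_eq (d : ZMod 589) : ∃ t : Fin 14 × Fin 7 × Fin 7,
    (baseBlocks589 t.1 t.2.1 : ZMod 589) - (baseBlocks589 t.1 t.2.2 : ZMod 589) = d := by
  have hmem : d.val ∈ differences589 := by
    rw [← testBit_bitMask, bitMask_differences589, Nat.testBit_two_pow_sub_one]
    exact decide_eq_true (ZMod.val_lt d)
  simp only [differences589, List.mem_flatMap, List.mem_map, List.mem_finRange, true_and] at hmem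
  obtain ⟨i, j, k, h⟩ := hmem
  refine ⟨(i, j, k), ?_⟩
  rw [← ZMod.natCast_zmod_val d, ← h, ZMod.natCast_mod, Nat.cast_add,
    Nat.cast_sub (baseBlocks589_lt i k).le, ZMod.natCast_self, zero_sub, sub_eq_add_neg]

/-- There exists a Steiner system S(2,7,589). -/
theorem exists_steiner_system_2_7_589 :
    ∃ (V : Type) (_ : Fintype V), Fintype.card V = 589 ∧
      ∃ 𝓑 : Finset (Finset V),
        (∀ b ∈ 𝓑, b.card = 7) ∧
        ∀ p : Finset V, p.card = 2 → ∃! b, b ∈ 𝓑 ∧ p ⊆ b := by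
  have hcard : Fintype.card {t : Fin 14 × Fin 7 × Fin 7 // t.2.1 ≠ t.2.2} + 1 =
      Fintype.card (ZMod 589) := by
    rw [ZMod.card]
    decide +kernel
  obtain ⟨hinj, hdiff⟩ := injective_and_existsUnique_of_surjective
    (fun i j => (baseBlocks589 i j : ZMod 589)) hcard fun d _ => exists_baseBlocks589_sub_eq d
  exact exists_steiner_system_of_differences (ZMod.card 589) (Fintype.card_fin 7) _ hinj hdiff
end

section
/- Let B₁, …, B₁₂ be the following twelve 7-element subsets of ℤ/505ℤ: {0,1,3,7,47,133,284}, {0,5,70,100,173,185,476}, {0,8,82,199,248,391,474}, {0,9,262,298,370,386,439}, {0,10,137,156,213,233,246}, {0,11,182,250,274,414,462}, {0,14,78,172,366,421,477}, {0,15,136,157,174,322,344}, {0,18,181,304,330,371,442}, {0,23,58,120,227,287,374}, {0,25,105,150,209,260,310}, {0,27,145,206,238,416,453}. Then the difference sets ΔB₁, …, ΔB₁₂ are pairwise disjoint, each has cardinality 42, and their union is (ℤ/505ℤ) \ {0}; consequently the translates {Bᵢ + g : 1 ≤ i ≤ 12, g ∈ ℤ/505ℤ} form the block set of a Steiner system S(2,7,505)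 on ℤ/505ℤ. -/
/-- The set of differences `ΔB = {a - c : a, c ∈ B, a ≠ c}`. -/
def diffSet (B : Finset (ZMod 505)) : Finset (ZMod 505) :=
  ((B ×ˢ B).filter fun p => p.1 ≠ p.2).image fun p => p.1 - p.2

/-- The 12 base blocks of the difference family on `ZMod 505`. -/
def baseBlocks : Fin 12 → Finset (ZMod 505) :=
  ![({0,1,3,7,47,133,284} : Finset (ZMod 505)),
   ({0,5,70,100,173,185,476} : Finset (ZMod 505)),
   ({0,8,82,199,248,391,474} : Finset (ZMod 505)),
   ({0,9,262,298,370,386,439} : Finset (ZMod 505)),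
   ({0,10,137,156,213,233,246} : Finset (ZMod 505)),
   ({0,11,182,250,274,414,462} : Finset (ZMod 505)),
   ({0,14,78,172,366,421,477} : Finset (ZMod 505)),
   ({0,15,136,157,174,322,344} : Finset (ZMod 505)),
   ({0,18,181,304,330,371,442} : Finset (ZMod 505)),
   ({0,23,58,120,227,287,374} : Finset (ZMod 505)),
   ({0,25,105,150,209,260,310} : Finset (ZMod 505)),
   ({0,27,145,206,238,416,453} : Finset (ZMod 505))]

section DifferenceFamily

variable {ι G : Type*} [Fintype ι] [AddCommGroup G] [Fintype G] [DecidableEq G]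

/-- If every nonzero element is a difference of some block, and there are no more pairs than
nonzero elements, then each nonzero element is a difference in only one way. -/
theorem injOn_sub_of_forall_exists_add_mem {B : ι → Finset G}
    (hcover : ∀ d ≠ 0, ∃ i, ∃ c ∈ B i, c + d ∈ B i)
    (hcard : ∑ i, (B i).offDiag.card + 1 ≤ Fintype.card G) :
    Set.InjOn (fun x : (_ : ι) × G × G => x.2.1 - x.2.2)
      (Finset.univ.sigma fun i => (B i).offDiag) := by
  refine Finset.card_image_iff.mp (le_antisymm Finset.card_image_le ?_)
  have hsub : Finset.univ.erase (0 : G) ⊆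
      (Finset.univ.sigma fun i => (B i).offDiag).image
        fun x : (_ : ι) × G × G => x.2.1 - x.2.2 := by
    intro d hd
    have hd0 : d ≠ 0 := Finset.ne_of_mem_erase hd
    obtain ⟨i, c, hc, hcd⟩ := hcover d hd0
    exact Finset.mem_image.mpr ⟨⟨i, c + d, c⟩, by simp [hc, hcd, hd0], by simp⟩
  have h := Finset.card_le_card hsub
  rw [Finset.card_erase_of_mem (Finset.mem_univ _), Finset.card_univ] at h
  rw [Finset.card_sigma]
  omega

/-- The translates of a difference family cover each pair of points exactly once. -/
theorem existsUnique_translate_of_injOn_sub {B : ι → Finset G}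
    (hcover : ∀ d ≠ 0, ∃ i, ∃ c ∈ B i, c + d ∈ B i)
    (hinj : Set.InjOn (fun x : (_ : ι) × G × G => x.2.1 - x.2.2)
      (Finset.univ.sigma fun i => (B i).offDiag))
    (p : Finset G) (hp : p.card = 2) :
    ∃! b, b ∈ (Finset.univ.image fun ig : ι × G => (B ig.1).image (· + ig.2)) ∧ p ⊆ b := by
  obtain ⟨x, y, hxy, rfl⟩ := Finset.card_eq_two.mp hp
  obtain ⟨i, c, hc, hcd⟩ := hcover (x - y) (sub_ne_zero.mpr hxy)
  refine ⟨(B i).image (· + (y - c)), ⟨Finset.mem_image.mpr ⟨(i, y - c), by simp, rfl⟩, ?_⟩, ?_⟩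
  · rw [Finset.insert_subset_iff, Finset.singleton_subset_iff]
    exact ⟨Finset.mem_image.mpr ⟨_, hcd, by abel⟩, Finset.mem_image.mpr ⟨_, hc, by abel⟩⟩
  · rintro b ⟨hb, hsub⟩
    obtain ⟨⟨j, h⟩, -, rfl⟩ := Finset.mem_image.mp hb
    rw [Finset.insert_subset_iff, Finset.singleton_subset_iff] at hsub
    obtain ⟨u, hu, rfl⟩ := Finset.mem_image.mp hsub.1
    obtain ⟨v, hv, rfl⟩ := Finset.mem_image.mp hsub.2
    have huv : u ≠ v := fun huv => hxy (by rw [huv])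
    have heq := @hinj ⟨j, u, v⟩ (by simp [hu, hv, huv])
      ⟨i, c + (u + h - (v + h)), c⟩ (by simpa [hc, sub_eq_zero, huv] using hcd) (by simp)
    simp only [Sigma.mk.injEq, heq_eq_eq, Prod.mk.injEq] at heq
    obtain ⟨rfl, -, rfl⟩ := heq
    simp

end DifferenceFamily

theorem diffSet_eq_image_offDiag (B : Finset (ZMod 505)) :
    diffSet B = B.offDiag.image fun p => p.1 - p.2 := by
  ext d
  simp [diffSet, and_assoc]

theorem card_baseBlocks (i : Fin 12) : (baseBlocks i).card = 7 := by
  revert i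
  decide +kernel

/-- A bit set in the bitwise disjunction of the powers `2 ^ f a`, `a ∈ s`, is one of the `f a`. -/
theorem exists_eq_of_testBit_fold_lor {α : Type*} {s : Finset α} {f : α → ℕ} {k : ℕ}
    (h : (s.fold (fun m n : ℕ => m ||| n) 0 fun a => 2 ^ f a).testBit k = true) :
    ∃ a ∈ s, f a = k := by
  classical
  induction s using Finset.induction_on with
  | empty => simp at h
  | insert a s ha ih =>
    rw [Finset.fold_insert ha, Nat.testBit_or, Bool.or_eq_true, Nat.testBit_two_pow,
      decide_eq_true_iff] at h
    rcases h with h | h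
    · exact ⟨a, Finset.mem_insert_self a s, h⟩
    · obtain ⟨b, hb, hbk⟩ := ih h
      exact ⟨b, Finset.mem_insert_of_mem hb, hbk⟩

theorem fold_lor_two_pow_sub_baseBlocks :
    ((Finset.univ.sigma fun i => baseBlocks i ×ˢ baseBlocks i).fold (fun m n : ℕ => m ||| n) 0
      fun x : (_ : Fin 12) × ZMod 505 × ZMod 505 => 2 ^ (x.2.1 - x.2.2).val) = 2 ^ 505 - 1 := by
  decide +kernel

theorem baseBlocks_cover (d : ZMod 505) : ∃ i, ∃ c ∈ baseBlocks i, c + d ∈ baseBlocks i := by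
  have hbit : (2 ^ 505 - 1).testBit d.val = true := by
    rw [Nat.testBit_two_pow_sub_one, decide_eq_true_iff]
    exact ZMod.val_lt d
  rw [← fold_lor_two_pow_sub_baseBlocks] at hbit
  obtain ⟨⟨i, a, c⟩, hx, hd⟩ := exists_eq_of_testBit_fold_lor hbit
  simp only [Finset.mem_sigma, Finset.mem_univ, Finset.mem_product, true_and] at hx
  refine ⟨i, c, hx.2, ?_⟩
  rw [← ZMod.val_injective 505 hd]
  simpa using hx.1

theorem injOn_sub_baseBlocks :
    Set.InjOn (fun x : (_ : Fin 12) × ZMod 505 × ZMod 505 => x.2.1 - x.2.2)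
      (Finset.univ.sigma fun i => (baseBlocks i).offDiag) := by
  refine injOn_sub_of_forall_exists_add_mem (fun d _ => baseBlocks_cover d) ?_
  simp [Finset.offDiag_card, card_baseBlocks, ZMod.card]

/-- The given 12 base blocks form a difference family on `ℤ/505ℤ`: their difference
sets are pairwise disjoint, each has 42 elements, and their union is `ℤ/505ℤ \ {0}`;
consequently the translates `Bᵢ + g` form the block set of a Steiner system
`S(2,7,505)` on `ℤ/505ℤ`. -/
theorem difference_family_zmod_505_6 :
    (∀ i j, i ≠ j → Disjoint (diffSet (baseBlocks i)) (diffSet (baseBlocks j))) ∧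
    (∀ i, (diffSet (baseBlocks i)).card = 42) ∧
    ((Finset.univ.biUnion fun i => diffSet (baseBlocks i)) = Finset.univ \ {0}) ∧
    ∀ p : Finset (ZMod 505), p.card = 2 →
      ∃! b, b ∈ (Finset.univ.image fun ig : Fin 12 × ZMod 505 =>
          (baseBlocks ig.1).image (· + ig.2)) ∧ p ⊆ b := by
  refine ⟨fun i j hij => ?_, fun i => ?_, ?_,
    existsUnique_translate_of_injOn_sub (fun d _ => baseBlocks_cover d)
      injOn_sub_baseBlocks⟩
  · simp only [diffSet_eq_image_offDiag, Finset.disjoint_left, Finset.mem_image]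
    rintro _ ⟨p, hp, rfl⟩ ⟨q, hq, hpq⟩
    have heq := @injOn_sub_baseBlocks ⟨j, q⟩ (by simpa using hq) ⟨i, p⟩ (by simpa using hp) hpq
    exact hij (congrArg Sigma.fst heq).symm
  · rw [diffSet_eq_image_offDiag, Finset.card_image_of_injOn, Finset.offDiag_card, card_baseBlocks]
    intro p hp q hq hpq
    have heq := @injOn_sub_baseBlocks ⟨i, p⟩ (by simpa using hp) ⟨i, q⟩ (by simpa using hq) hpq
    simpa using heq
  · ext d
    simp only [diffSet_eq_image_offDiag, Finset.mem_biUnion, Finset.mem_univ, true_and,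
      Finset.mem_image, Finset.mem_offDiag, Finset.mem_sdiff, Finset.mem_singleton]
    constructor
    · rintro ⟨i, p, ⟨-, -, hne⟩, rfl⟩
      exact sub_ne_zero.mpr hne
    · intro hd
      obtain ⟨i, c, hc, hcd⟩ := baseBlocks_cover d
      exact ⟨i, (c + d, c), ⟨hcd, hc, by simpa using hd⟩, by simp⟩
end
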